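/- Let g_k = Σ_{j=1}^{k} |{i : 2 ≤ i ≤ m(l+1), I_{l,l+1}(j,i) = 1}| for any l with m(l) ≥ k (this number is independent of the choice of such l), and for l ≥ k set ℤ(l;k) = {x ∈ ℤ^{m(l)−1} : x_i = 0 for all i ≤ g_k} ⊆ ℤ^{m(l)−1}, with ℤ(l;0) = ℤ^{m(l)−1}. Then: (i) the map given by J_{l+1,l} sends ℤ(l;k) into ℤ(l+1;k+1); and (ii) for every k ≥ 1, the inductive limit G_k of the system {J_{k+n+1,k+n} : ℤ(k+n;n) → ℤ(k+n+1;n+1)}_{n ≥ 0} is isomorphic to the additive group C(𝒦,ℤ) of continuous integer-valued functions on the Cantor space 𝒦 = {0,1}^ℕ. -/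

import Mathlib

noncomputable section



open Finset

/-- Admissibility for the golden-mean (Fibonacci) shift: words over the alphabet
`{1,2}` (coded as `Fin 2`, where `0` codes the letter `1` and `1` codes the letter `2`)
with no two consecutive letters equal to `2`. -/
def DyckAdm (l : ℕ) (w : Fin l → Fin 2) : Prop :=
  ∀ i j : Fin l, (j : ℕ) = (i : ℕ) + 1 → ¬(w i = 1 ∧ w j = 1)

instance (l : ℕ) : DecidablePred (DyckAdm l) := fun w => by
  unfold DyckAdm; infer_instance

/-- The set `W_l` of admissible words of length `l`. -/
def Wset (l : ℕ) : Finset (Fin l → Fin 2) := univ.filter (DyckAdm l)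

/-- `m(l)`, the number of admissible words of length `l`. -/
def mW (l : ℕ) : ℕ := (Wset l).card

/-- Lexicographic (from the left) strict order on words. -/
def lexLt (l : ℕ) (u w : Fin l → Fin 2) : Prop :=
  ∃ i : Fin l, (∀ j : Fin l, j < i → u j = w j) ∧ u i < w i

instance (l : ℕ) : DecidableRel (lexLt l) := fun u w => by
  unfold lexLt; infer_instance

/-- The (1-based) position of an admissible word in the lexicographic ordering of `W_l`,
identifying `W_l` with `{1, …, m(l)}`. -/
def rankW (l : ℕ) (w : Fin l → Fin 2) : ℕ :=
  1 + ((Wset l).filter (fun u => lexLt l u w)).card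

/-- The matrix `I_{l,l+1}` (1-based indices, entries outside `{1,…,m(l)} × {1,…,m(l+1)}`
are `0`): `I_{l,l+1}(w,w') = 1` iff the word `w'` with its last letter deleted is `w`. -/
def Imat (l : ℕ) : ℕ → ℕ → ℤ := fun i j =>
  if ∃ w ∈ Wset l, ∃ w' ∈ Wset (l + 1),
      rankW l w = i ∧ rankW (l + 1) w' = j ∧ (∀ k : Fin l, w k = w' k.castSucc)
  then 1 else 0

/-- The matrix `M_{l,l+1}` (1-based indices):
`M_{l,l+1}(w,w') = |{k ∈ {1,2} : w' = k·w}| + ε(w,w')`, where `ε(w,w') = 1` iff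
`F(w_1,w'_1) = 1` and `(w_2,…,w_l) = (w'_1,…,w'_{l-1})`; `M_{0,1} = [3 2]`.
(Here `F(a,b) = 0` iff both letters are `2`, i.e. both codes are `1`.) -/
def Mmat : ℕ → ℕ → ℕ → ℤ
  | 0, i, j => if i = 1 ∧ j = 1 then 3 else if i = 1 ∧ j = 2 then 2 else 0
  | (l + 1), i, j =>
      ∑ w ∈ Wset (l + 1), ∑ w' ∈ Wset (l + 2),
        if rankW (l + 1) w = i ∧ rankW (l + 2) w' = j then
          ((if (∀ t : Fin (l + 1), w' t.succ = w t) then (1 : ℤ) else 0) +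
           (if (¬(w 0 = 1 ∧ w' 0 = 1)) ∧
               (∀ t : Fin (l + 1), (t : ℕ) ≠ 0 →
                 w t = w' ⟨(t : ℕ) - 1,
                   (Nat.sub_le _ _).trans_lt (t.isLt.trans (Nat.lt_succ_self _))⟩)
            then (1 : ℤ) else 0))
        else 0

/-- The matrices `S_l` (of size `m(l-1) × m(l+1)`, 1-based indices):
`S_0 = [1 1]`, `S_1 = [1 1 1]`, `S_{l+2} = [[S_{l+1}, 0], [0, S_l]]` (block diagonal). -/
def Smat : ℕ → ℕ → ℕ → ℤ
  | 0, i, j => if i = 1 ∧ (1 ≤ j ∧ j ≤ 2) then 1 else 0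
  | 1, i, j => if i = 1 ∧ (1 ≤ j ∧ j ≤ 3) then 1 else 0
  | (l + 2), i, j =>
      if i ≤ mW l then (if j ≤ mW (l + 2) then Smat (l + 1) i j else 0)
      else (if j ≤ mW (l + 2) then 0 else Smat l (i - mW l) (j - mW (l + 2)))

/-- The matrix `J_{l+1,l}` (1-based indices, size `(m(l+1)-1) × (m(l)-1)`):
its first row is zero and `J_{l+1,l}(i,j) = I_{l,l+1}(j+1, i+1)` for `i ≥ 2`. -/
def Jnat (l : ℕ) : ℕ → ℕ → ℤ := fun i j =>
  if i ≤ 1 ∨ j = 0 then 0 else Imat l (j + 1) (i + 1)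

/-- `J_{l+1,l}` as an additive map `ℤ^{m(l)-1} → ℤ^{m(l+1)-1}`. -/
def Jhom (l : ℕ) : (Fin (mW l - 1) → ℤ) →+ (Fin (mW (l + 1) - 1) → ℤ) :=
  (Matrix.mulVecLin
    (fun (i : Fin (mW (l + 1) - 1)) (j : Fin (mW l - 1)) =>
      Jnat l ((i : ℕ) + 1) ((j : ℕ) + 1))).toAddMonoidHom

/-- The composition `J_{l+j,l+j-1} ∘ ⋯ ∘ J_{l+1,l} : ℤ^{m(l)-1} → ℤ^{m(l+j)-1}`. -/
def Jpush (l : ℕ) : ∀ j : ℕ, (Fin (mW l - 1) → ℤ) →+ (Fin (mW (l + j) - 1) → ℤ)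
  | 0 => AddMonoidHom.id _
  | (j + 1) => (Jhom (l + j)).comp (Jpush l j)

/-- `id_ℤ ⊕ J_{n+1,n} : ℤ ⊕ ℤ^{m(n)-1} → ℤ ⊕ ℤ^{m(n+1)-1}`, written as a map
`ℤ^{m(n)} → ℤ^{m(n+1)}` (the `ℤ` summand being the `0`-th coordinate). -/
def idJ (n : ℕ) : (Fin (mW n) → ℤ) →+ (Fin (mW (n + 1)) → ℤ) :=
  (Matrix.mulVecLin
    (fun (i : Fin (mW (n + 1))) (j : Fin (mW n)) =>
      if (i : ℕ) = 0 ∧ (j : ℕ) = 0 then 1 else Jnat n (i : ℕ) (j : ℕ))).toAddMonoidHom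

/-- `g_k` computed at level `l`: `Σ_{j=1}^{k} |{i : 2 ≤ i ≤ m(l+1), I_{l,l+1}(j,i) = 1}|`. -/
def gAt (l k : ℕ) : ℕ :=
  ∑ j ∈ Finset.Icc 1 k, ((Finset.Icc 2 (mW (l + 1))).filter (fun i => Imat l j i = 1)).card

/-- The sequence `g_k` (computed at level `l = k`, for which `m(l) ≥ k`). -/
def gk (k : ℕ) : ℕ := gAt k k

/-- The subgroup `ℤ(l;k) = {x ∈ ℤ^{m(l)-1} : x_i = 0 for all i ≤ g_k}` (1-based
coordinates; `ℤ(l;0) = ℤ^{m(l)-1}` since `g_0 = 0`). -/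
def Zsub (l k : ℕ) : AddSubgroup (Fin (mW l - 1) → ℤ) where
  carrier := {x | ∀ i : Fin (mW l - 1), (i : ℕ) + 1 ≤ gk k → x i = 0}
  add_mem' := by
    intro a b ha hb i hi
    simp [Pi.add_apply, ha i hi, hb i hi]
  zero_mem' := by intro i hi; rfl
  neg_mem' := by
    intro a ha i hi
    simp [Pi.neg_apply, ha i hi]

/-- The Cantor space `𝒦 = {0,1}^ℕ`. -/
abbrev Kspace : Type := ℕ → Bool

section Free
variable {R M : Type*} [CommRing R] [IsDomain R] [IsPrincipalIdealRing R] [AddCommGroup M] [Module R M]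

theorem exists_linearIndepOn_superset_span_eq {N N' : Submodule R M} (hle : N ≤ N') (hfg : N'.FG)
    (hN : ∀ (r : R) (x : M), r ≠ 0 → r • x ∈ N → x ∈ N) {S : Set M}
    (hS : LinearIndepOn R id S) (hspan : Submodule.span R S = N) :
    ∃ S' : Set M, S ⊆ S' ∧ LinearIndepOn R id S' ∧ Submodule.span R S' = N' := by
  have : Module.IsTorsionFree R (M ⧸ N) := by
    refine .of_smul_eq_zero fun r y h => ?_
    obtain ⟨x, rfl⟩ := N.mkQ_surjective y
    by_contra! hc
    refine hc.2 ?_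
    rw [← map_smul] at h
    simp only [Submodule.mkQ_apply, Submodule.Quotient.mk_eq_zero] at h ⊢
    exact hN r x hc.1 h
  have : Module.Finite R (N'.map N.mkQ) := Module.Finite.iff_fg.2 (hfg.map _)
  have : Module.IsTorsionFree R (N'.map N.mkQ) := inferInstance
  let b := Module.Free.chooseBasis R (N'.map N.mkQ)
  have hex : ∀ i, ∃ x ∈ N', N.mkQ x = b i := fun i => (b i).2
  choose t htmem ht using hex
  have hb : LinearIndependent R (N.mkQ ∘ t) := by
    have : (N.mkQ ∘ t) = (N'.map N.mkQ).subtype ∘ b := funext ht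
    rw [this]
    exact b.linearIndependent.map' _ (Submodule.ker_subtype _)
  refine ⟨S ∪ Set.range t, Set.subset_union_left, ?_, ?_⟩
  · exact LinearIndepOn.union_id_of_quotient (M' := N) (hspan ▸ Submodule.subset_span) hS
      ((linearIndepOn_range_iff (LinearIndependent.injective hb).of_comp N.mkQ).2 hb)
  · rw [Submodule.span_union, hspan]
    refine le_antisymm (sup_le hle (Submodule.span_le.2 ?_)) fun x hx => ?_
    · rintro _ ⟨i, rfl⟩
      exact htmem i
    · have h1 : (⟨N.mkQ x, Submodule.mem_map_of_mem hx⟩ : N'.map N.mkQ) ∈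
          Submodule.span R (Set.range b) := b.span_eq ▸ Submodule.mem_top
      have h2 := Submodule.mem_map_of_mem (f := (N'.map N.mkQ).subtype) h1
      rw [Submodule.map_span, ← Set.range_comp,
        show (N'.map N.mkQ).subtype ∘ b = N.mkQ ∘ t from (funext ht).symm, Set.range_comp,
        ← Submodule.map_span] at h2
      obtain ⟨y, hy, hxy⟩ := h2
      have h3 : x - y ∈ N := by
        rw [← Submodule.Quotient.eq]
        exact hxy.symm
      rw [← sub_add_cancel x y]
      exact Submodule.add_mem_sup h3 hy

theorem free_iSup_of_monotone_of_pure [Module.IsTorsionFree R M] {A : ℕ → Submodule R M}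
    (hA : Monotone A) (hfg : ∀ n, (A n).FG)
    (hpure : ∀ (n : ℕ) (r : R) (x : M), r ≠ 0 → r • x ∈ A n → x ∈ A n) :
    Module.Free R ↥(⨆ n, A n) := by
  obtain ⟨S₀, -, hS₀⟩ := exists_linearIndepOn_superset_span_eq (bot_le : ⊥ ≤ A 0) (hfg 0)
    (fun r x hr hx => by simpa [hr] using hx) (linearIndepOn_empty R id) (by simp)
  have step : ∀ (n : ℕ) (S : {S : Set M // LinearIndepOn R id S ∧ Submodule.span R S = A n}),
      ∃ S' : {S : Set M // LinearIndepOn R id S ∧ Submodule.span R S = A (n + 1)},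
        S.1 ⊆ S'.1 := fun n S => by
    obtain ⟨S', h, hS'⟩ := exists_linearIndepOn_superset_span_eq (hA n.le_succ) (hfg (n + 1))
      (hpure n) S.2.1 S.2.2
    exact ⟨⟨S', hS'⟩, h⟩
  choose next hnext using step
  let T : ∀ n, {S : Set M // LinearIndepOn R id S ∧ Submodule.span R S = A n} :=
    fun n => Nat.rec ⟨S₀, hS₀⟩ next n
  have hT : Monotone fun n => (T n).1 := monotone_nat_of_le_succ fun n => hnext n (T n)
  have hind : LinearIndepOn R id (⋃ n, (T n).1) :=
    linearIndepOn_iUnion_of_directed hT.directed_le fun n => (T n).2.1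
  have hspan : Submodule.span R (⋃ n, (T n).1) = ⨆ n, A n := by
    rw [Submodule.span_iUnion]
    exact iSup_congr fun n => (T n).2.2
  rw [← hspan]
  have := Module.Free.of_basis (Module.Basis.span hind)
  rwa [show Set.range (fun x : ↥(⋃ n, (T n).1) => id (x : M)) = ⋃ n, (T n).1 from
    Subtype.range_coe] at this
end Free

theorem countable_continuousMap_int : Countable C(ℕ → Bool, ℤ) := by
  have : DiscreteTopology C(ℕ → Bool, ℤ) :=
    .of_forall_le_dist one_pos fun f g hfg => by
      obtain ⟨x, hx⟩ := DFunLike.ne_iff.1 hfg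
      exact (Int.pairwise_one_le_dist hx).trans (ContinuousMap.dist_apply_le_dist x)
  exact (TopologicalSpace.separableSpace_iff_countable).1 inferInstance

theorem free_continuousMap_int (X : Type*) [TopologicalSpace X] [CompactSpace X] [T2Space X]
    [TotallyDisconnectedSpace X] : Module.Free ℤ C(X, ℤ) := by
  have : Module.Free ℤ (LocallyConstant X ℤ) := LocallyConstant.freeOfProfinite (Profinite.of X)
  refine Module.Free.of_equiv (LinearEquiv.ofBijective
    (LocallyConstant.toContinuousMapLinearMap (X := X) (Y := ℤ) ℤ)
    ⟨LocallyConstant.toContinuousMap_injective, fun f =>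
      ⟨⟨f, (IsLocallyConstant.iff_continuous f).2 f.continuous⟩, rfl⟩⟩)

theorem nonempty_linearEquiv_continuousMap_int {G : Submodule ℤ C(ℕ → Bool, ℤ)}
    [Module.Free ℤ G] (hG : ∀ n : ℕ, (n : Cardinal) ≤ Module.rank ℤ G) :
    Nonempty (G ≃ₗ[ℤ] C(ℕ → Bool, ℤ)) := by
  have := countable_continuousMap_int
  have := free_continuousMap_int (ℕ → Bool)
  refine nonempty_linearEquiv_of_rank_eq (le_antisymm (Submodule.rank_le G) ?_)
  exact ((rank_le_card ℤ _).trans Cardinal.mk_le_aleph0).trans (Cardinal.aleph0_le.2 hG)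

section Words

variable {l : ℕ}

theorem mem_Wset {w : Fin l → Fin 2} : w ∈ Wset l ↔ DyckAdm l w := by simp [Wset]

theorem lexLt_iff {u w : Fin l → Fin 2} : lexLt l u w ↔ toLex u < toLex w := Iff.rfl

theorem not_lexLt_zero (u : Fin l → Fin 2) : ¬lexLt l u 0 := by
  rintro ⟨i, -, hi⟩
  simp at hi

theorem zero_lexLt {w : Fin l → Fin 2} (hw : w ≠ 0) : lexLt l 0 w := by
  rcases lt_trichotomy (toLex (0 : Fin l → Fin 2)) (toLex w) with h | h | h
  · exact h
  · exact absurd (toLex.injective h).symm hw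
  · exact absurd h (not_lexLt_zero w)

theorem zero_mem_Wset (l : ℕ) : (0 : Fin l → Fin 2) ∈ Wset l :=
  mem_Wset.2 fun _ _ _ h => by simp at h

theorem rankW_lt_of_lexLt {u w : Fin l → Fin 2} (hu : u ∈ Wset l) (h : lexLt l u w) :
    rankW l u < rankW l w := by
  refine Nat.add_lt_add_left (card_lt_card ?_) 1
  refine ssubset_iff_of_subset (fun v hv => ?_) |>.2 ⟨u, by simp [hu, h], ?_⟩
  · rw [mem_filter] at hv ⊢
    exact ⟨hv.1, lt_trans (lexLt_iff.1 hv.2) h⟩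
  · rw [mem_filter]
    exact fun hv => lt_irrefl _ (lexLt_iff.1 hv.2)

theorem lexLt_of_rankW_lt {u w : Fin l → Fin 2} (hw : w ∈ Wset l) (h : rankW l u < rankW l w) :
    lexLt l u w := by
  rcases lt_trichotomy (toLex u) (toLex w) with h' | h' | h'
  · exact h'
  · rw [toLex.injective h'] at h
    exact absurd h (lt_irrefl _)
  · exact absurd (rankW_lt_of_lexLt hw h') h.not_gt

theorem rankW_injOn (l : ℕ) : Set.InjOn (rankW l) (Wset l) := by
  intro u hu w hw h
  rcases lt_trichotomy (toLex u) (toLex w) with h' | h' | h'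
  · exact absurd h (rankW_lt_of_lexLt hu h').ne
  · exact toLex.injective h'
  · exact absurd h (rankW_lt_of_lexLt hw h').ne'

theorem rankW_pos (w : Fin l → Fin 2) : 1 ≤ rankW l w := Nat.le_add_right _ _

theorem rankW_le {w : Fin l → Fin 2} (hw : w ∈ Wset l) : rankW l w ≤ mW l := by
  rw [rankW, add_comm, Nat.succ_le_iff]
  refine card_lt_card ((ssubset_iff_of_subset (filter_subset _ _)).2 ⟨w, hw, ?_⟩)
  rw [mem_filter]
  exact fun hv => lt_irrefl _ (lexLt_iff.1 hv.2)

theorem rankW_zero (l : ℕ) : rankW l 0 = 1 := by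
  simp [rankW, filter_false_of_mem fun u _ => not_lexLt_zero u]

theorem image_rankW (l : ℕ) : (Wset l).image (rankW l) = Icc 1 (mW l) := by
  refine eq_of_subset_of_card_le (fun i hi => ?_) ?_
  · obtain ⟨w, hw, rfl⟩ := mem_image.1 hi
    exact mem_Icc.2 ⟨rankW_pos w, rankW_le hw⟩
  · rw [card_image_of_injOn (rankW_injOn l), Nat.card_Icc, Nat.add_sub_cancel, mW]

theorem exists_rankW_eq {i : ℕ} (h1 : 1 ≤ i) (h2 : i ≤ mW l) : ∃ w ∈ Wset l, rankW l w = i := by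
  have := mem_Icc.2 ⟨h1, h2⟩
  rwa [← image_rankW, mem_image] at this

theorem mW_zero : mW 0 = 1 := by decide

theorem mW_one : mW 1 = 2 := by decide

/-! ### Deleting the last letter -/

theorem init_mem_Wset {w : Fin (l + 1) → Fin 2} (hw : w ∈ Wset (l + 1)) :
    Fin.init w ∈ Wset l :=
  mem_Wset.2 fun i j hij => mem_Wset.1 hw i.castSucc j.castSucc (by simpa using hij)

theorem snoc_zero_mem_Wset {u : Fin l → Fin 2} (hu : u ∈ Wset l) :
    (Fin.snoc u 0 : Fin (l + 1) → Fin 2) ∈ Wset (l + 1) := by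
  refine mem_Wset.2 fun i j hij => ?_
  induction j using Fin.lastCases with
  | last => simp
  | cast j =>
    induction i using Fin.lastCases with
    | last => simp
    | cast i => simpa using mem_Wset.1 hu i j (by simpa using hij)

theorem snoc_zero_one_mem_Wset (l : ℕ) :
    (Fin.snoc (0 : Fin l → Fin 2) 1 : Fin (l + 1) → Fin 2) ∈ Wset (l + 1) := by
  refine mem_Wset.2 fun i j hij => ?_
  induction i using Fin.lastCases with
  | last =>
    simp at hij
    omega
  | cast i => simp

theorem lexLt_of_lexLt_init {u w : Fin (l + 1) → Fin 2} (h : lexLt l (Fin.init u) (Fin.init w)) :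
    lexLt (l + 1) u w := by
  obtain ⟨i, hi, hlt⟩ := h
  refine ⟨i.castSucc, fun j hj => ?_, hlt⟩
  induction j using Fin.lastCases with
  | last => exact absurd hj (Fin.castSucc_lt_last i).not_gt
  | cast j => exact hi j (by simpa using hj)

theorem rankW_init_mono {u w : Fin (l + 1) → Fin 2} (hu : u ∈ Wset (l + 1))
    (hw : w ∈ Wset (l + 1)) (h : rankW (l + 1) u ≤ rankW (l + 1) w) :
    rankW l (Fin.init u) ≤ rankW l (Fin.init w) := by
  by_contra! hlt
  exact absurd (rankW_lt_of_lexLt hw (lexLt_of_lexLt_init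
    (lexLt_of_rankW_lt (init_mem_Wset hu) hlt))) h.not_gt

theorem rankW_snoc_zero_one (l : ℕ) :
    rankW (l + 1) (Fin.snoc (0 : Fin l → Fin 2) 1 : Fin (l + 1) → Fin 2) = 2 := by
  have : (Wset (l + 1)).filter (fun u => lexLt (l + 1) u (Fin.snoc (0 : Fin l → Fin 2) 1))
      = {0} := by
    ext u
    rw [mem_filter, mem_singleton]
    constructor
    · rintro ⟨-, i, hi, hlt⟩
      induction i using Fin.lastCases with
      | last =>
        ext j : 1
        induction j using Fin.lastCases with
        | last => simpa [Fin.lt_one_iff] using hlt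
        | cast j => simpa using hi j.castSucc (Fin.castSucc_lt_last j)
      | cast i => simp at hlt
    · rintro rfl
      exact ⟨zero_mem_Wset _, zero_lexLt fun h => by simpa using congrFun h (Fin.last l)⟩
  rw [rankW, this, card_singleton]

/-! ### Prepending a letter -/

theorem cons_zero_mem_Wset {u : Fin l → Fin 2} (hu : u ∈ Wset l) :
    (Fin.cons 0 u : Fin (l + 1) → Fin 2) ∈ Wset (l + 1) := by
  refine mem_Wset.2 fun i j hij => ?_
  induction i using Fin.cases with
  | zero => simp
  | succ i =>
    induction j using Fin.cases with
    | zero => simp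
    | succ j => simpa using mem_Wset.1 hu i j (by simpa using hij)

theorem cons_one_cons_zero_mem_Wset {u : Fin l → Fin 2} (hu : u ∈ Wset l) :
    (Fin.cons 1 (Fin.cons 0 u : Fin (l + 1) → Fin 2) : Fin (l + 2) → Fin 2) ∈ Wset (l + 2) := by
  refine mem_Wset.2 fun i j hij => ?_
  induction j using Fin.cases with
  | zero => simp at hij
  | succ j =>
    induction i using Fin.cases with
    | zero =>
      obtain rfl : j = 0 := Fin.ext (by simpa using hij)
      simp
    | succ i => simpa using mem_Wset.1 (cons_zero_mem_Wset hu) i j (by simpa using hij)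

theorem tail_mem_Wset {w : Fin (l + 1) → Fin 2} (hw : w ∈ Wset (l + 1)) :
    Fin.tail w ∈ Wset l :=
  mem_Wset.2 fun i j hij => mem_Wset.1 hw i.succ j.succ (by simpa using hij)

theorem lexLt_cons_zero {u v : Fin l → Fin 2} :
    lexLt (l + 1) (Fin.cons 0 u) (Fin.cons 0 v) ↔ lexLt l u v := by
  constructor
  · rintro ⟨i, hi, hlt⟩
    induction i using Fin.cases with
    | zero => simp at hlt
    | succ i => exact ⟨i, fun j hj => by simpa using hi j.succ (by simpa using hj), by simpa using hlt⟩
  · rintro ⟨i, hi, hlt⟩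
    refine ⟨i.succ, fun j hj => ?_, by simpa using hlt⟩
    induction j using Fin.cases with
    | zero => rfl
    | succ j => simpa using hi j (by simpa using hj)

theorem cons_zero_lexLt_of_ne_zero {w : Fin (l + 1) → Fin 2} (hw : w 0 ≠ 0) (u : Fin l → Fin 2) :
    lexLt (l + 1) (Fin.cons 0 u) w :=
  ⟨0, fun j hj => absurd hj (Fin.not_lt_zero j), by simpa using Fin.pos_of_ne_zero hw⟩

theorem cons_injective_right (a : Fin 2) :
    Function.Injective fun u : Fin l → Fin 2 => (Fin.cons a u : Fin (l + 1) → Fin 2) :=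
  Fin.cons_right_injective (α := fun _ => Fin 2) a

theorem rankW_cons_zero (u : Fin l → Fin 2) : rankW (l + 1) (Fin.cons 0 u) = rankW l u := by
  have : (Wset (l + 1)).filter (fun v => lexLt (l + 1) v (Fin.cons 0 u)) =
      ((Wset l).filter (fun v => lexLt l v u)).image fun v => Fin.cons 0 v := by
    ext v
    simp only [mem_filter, mem_image]
    constructor
    · rintro ⟨hv, hlt⟩
      have hv0 : v 0 = 0 := by
        by_contra h
        exact lt_asymm (lexLt_iff.1 hlt) (cons_zero_lexLt_of_ne_zero h u)
      have hcons : Fin.cons 0 (Fin.tail v) = v := by rw [← hv0, Fin.cons_self_tail]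
      rw [← hcons, lexLt_cons_zero] at hlt
      exact ⟨Fin.tail v, ⟨tail_mem_Wset hv, hlt⟩, hcons⟩
    · rintro ⟨v, ⟨hv, hlt⟩, rfl⟩
      exact ⟨cons_zero_mem_Wset hv, lexLt_cons_zero.2 hlt⟩
  rw [rankW, this, card_image_of_injective _ (cons_injective_right 0), rankW]

theorem rankW_le_mW_iff {w : Fin (l + 1) → Fin 2} (hw : w ∈ Wset (l + 1)) :
    rankW (l + 1) w ≤ mW l ↔ w 0 = 0 := by
  constructor
  · intro h
    by_contra hw0
    refine absurd h (not_le.2 ?_)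
    rw [rankW, mW, ← card_image_of_injective _ (cons_injective_right 0),
      Nat.lt_one_add_iff]
    refine card_le_card fun v hv => ?_
    obtain ⟨u, hu, rfl⟩ := mem_image.1 hv
    exact mem_filter.2 ⟨cons_zero_mem_Wset hu, cons_zero_lexLt_of_ne_zero hw0 u⟩
  · intro h
    have hcons : Fin.cons 0 (Fin.tail w) = w := by rw [← h, Fin.cons_self_tail]
    rw [← hcons, rankW_cons_zero]
    exact rankW_le (tail_mem_Wset hw)

theorem mW_add_le (l : ℕ) : mW (l + 1) + mW l ≤ mW (l + 2) := by
  rw [mW, mW, mW, ← card_image_of_injective (Wset (l + 1)) (cons_injective_right 0),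
    ← card_image_of_injective (Wset l) ((cons_injective_right 1).comp (cons_injective_right 0)),
    ← card_union_of_disjoint]
  · refine card_le_card (union_subset ?_ ?_) <;> intro v hv <;>
      obtain ⟨u, hu, rfl⟩ := mem_image.1 hv
    · exact cons_zero_mem_Wset hu
    · exact cons_one_cons_zero_mem_Wset hu
  · refine disjoint_left.2 fun v hv hv' => ?_
    obtain ⟨u, -, rfl⟩ := mem_image.1 hv
    obtain ⟨u', -, h⟩ := mem_image.1 hv'
    simpa using congrFun h 0

theorem lt_mW_and_two_mul_le (l : ℕ) : l < mW l ∧ 2 * l ≤ mW l + 2 ∧ mW l ≤ mW (l + 1) := by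
  induction l using Nat.twoStepInduction with
  | zero => simp [mW_zero, mW_one]
  | one =>
    have := mW_add_le 0
    simp only [mW_one, mW_zero, Nat.reduceAdd] at this ⊢
    omega
  | more l h h' =>
    have h1 := mW_add_le l
    have h2 := mW_add_le (l + 1)
    simp only [add_assoc, Nat.reduceAdd] at *
    omega

theorem monotone_mW : Monotone mW := monotone_nat_of_le_succ fun l => (lt_mW_and_two_mul_le l).2.2

end Words

section ParentRank

variable {l : ℕ}

/-- The position in `W_l` of the word obtained from the `i`-th word of `W_{l+1}` by deleting its
last letter (and `0` if there is no such word). -/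
def parentRank (l i : ℕ) : ℕ :=
  if h : 1 ≤ i ∧ i ≤ mW (l + 1) then rankW l (Fin.init (exists_rankW_eq h.1 h.2).choose) else 0

theorem parentRank_rankW {w : Fin (l + 1) → Fin 2} (hw : w ∈ Wset (l + 1)) :
    parentRank l (rankW (l + 1) w) = rankW l (Fin.init w) := by
  have h : 1 ≤ rankW (l + 1) w ∧ rankW (l + 1) w ≤ mW (l + 1) := ⟨rankW_pos w, rankW_le hw⟩
  have hspec := (exists_rankW_eq h.1 h.2).choose_spec
  rw [parentRank, dif_pos h, rankW_injOn _ hspec.1 hw hspec.2]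

theorem parentRank_mono {i j : ℕ} (hi : 1 ≤ i) (hij : i ≤ j) (hj : j ≤ mW (l + 1)) :
    parentRank l i ≤ parentRank l j := by
  obtain ⟨u, hu, rfl⟩ := exists_rankW_eq hi (hij.trans hj)
  obtain ⟨w, hw, rfl⟩ := exists_rankW_eq (hi.trans hij) hj
  rw [parentRank_rankW hu, parentRank_rankW hw]
  exact rankW_init_mono hu hw hij

theorem parentRank_one (l : ℕ) : parentRank l 1 = 1 := by
  rw [← rankW_zero (l + 1), parentRank_rankW (zero_mem_Wset _), rankW_zero]
  exact rankW_zero l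

theorem parentRank_two (l : ℕ) : parentRank l 2 = 1 := by
  rw [← rankW_snoc_zero_one l, parentRank_rankW (snoc_zero_one_mem_Wset l), Fin.init_snoc,
    rankW_zero]

theorem two_le_mW_succ (l : ℕ) : 2 ≤ mW (l + 1) := mW_one ▸ monotone_mW (by omega)

theorem exists_parentRank_eq {j : ℕ} (hj : 1 ≤ j) (hjl : j ≤ mW l) :
    ∃ i ∈ Icc 2 (mW (l + 1)), parentRank l i = j := by
  obtain ⟨u, hu, rfl⟩ := exists_rankW_eq hj hjl
  have hw := snoc_zero_mem_Wset hu
  have hp := parentRank_rankW hw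
  rw [Fin.init_snoc] at hp
  have hpos := rankW_pos (Fin.snoc u 0 : Fin (l + 1) → Fin 2)
  rcases hpos.eq_or_lt with h | h
  · rw [← h, parentRank_one] at hp
    exact ⟨2, mem_Icc.2 ⟨le_rfl, two_le_mW_succ l⟩, (parentRank_two l).trans hp⟩
  · exact ⟨_, mem_Icc.2 ⟨h, rankW_le hw⟩, hp⟩

theorem parentRank_succ {i : ℕ} (hi : 1 ≤ i) (hil : i ≤ mW (l + 1)) :
    parentRank (l + 1) i = parentRank l i := by
  obtain ⟨u, hu, rfl⟩ := exists_rankW_eq hi hil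
  rw [parentRank_rankW hu, ← rankW_cons_zero, parentRank_rankW (cons_zero_mem_Wset hu),
    ← rankW_cons_zero (Fin.init u)]
  congr 1
  ext j : 1
  induction j using Fin.cases <;> rfl

theorem le_mW_of_parentRank_le {i : ℕ} (hi : 1 ≤ i) (hil : i ≤ mW (l + 2))
    (h : parentRank (l + 1) i ≤ mW l) : i ≤ mW (l + 1) := by
  obtain ⟨w, hw, rfl⟩ := exists_rankW_eq hi hil
  rw [parentRank_rankW hw, rankW_le_mW_iff (init_mem_Wset hw)] at h
  exact (rankW_le_mW_iff hw).2 h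

theorem Imat_eq (l j i : ℕ) :
    Imat l j i = if i ∈ Icc 1 (mW (l + 1)) ∧ parentRank l i = j then 1 else 0 := by
  refine if_congr ?_ rfl rfl
  constructor
  · rintro ⟨w, -, w', hw', rfl, rfl, h⟩
    refine ⟨mem_Icc.2 ⟨rankW_pos w', rankW_le hw'⟩, ?_⟩
    rw [parentRank_rankW hw', show w = Fin.init w' from funext h]
  · rintro ⟨hi, rfl⟩
    obtain ⟨w, hw, rfl⟩ := exists_rankW_eq (mem_Icc.1 hi).1 (mem_Icc.1 hi).2
    exact ⟨Fin.init w, init_mem_Wset hw, w, hw, (parentRank_rankW hw).symm, rfl, fun _ => rfl⟩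

theorem one_le_parentRank {i : ℕ} (hi : 1 ≤ i) (hil : i ≤ mW (l + 1)) : 1 ≤ parentRank l i :=
  parentRank_one l ▸ parentRank_mono le_rfl hi hil

theorem gAt_eq (l k : ℕ) :
    gAt l k = #{i ∈ Icc 2 (mW (l + 1)) | parentRank l i ≤ k} := by
  rw [card_eq_sum_card_fiberwise (f := parentRank l) (t := Icc 1 k), gAt]
  · refine sum_congr rfl fun j hj => congrArg card ?_
    ext i
    simp only [mem_filter, mem_Icc, Imat_eq] at hj ⊢
    split_ifs with h
    · simp only [and_true]
      omega
    · simp only [zero_ne_one, and_false, false_iff]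
      omega
  · intro i hi
    simp only [coe_filter, mem_Icc, Set.mem_ofPred_eq, coe_Icc, Set.mem_Icc] at hi ⊢
    exact ⟨one_le_parentRank (by omega) hi.1.2, hi.2⟩

theorem gAt_succ {k : ℕ} (hk : k ≤ mW l) : gAt (l + 1) k = gAt l k := by
  rw [gAt_eq, gAt_eq]
  congr 1
  ext i
  simp only [mem_filter, mem_Icc]
  constructor
  · rintro ⟨⟨h2, hi⟩, hp⟩
    have hi' := le_mW_of_parentRank_le (by omega) hi (hp.trans hk)
    exact ⟨⟨h2, hi'⟩, parentRank_succ (by omega) hi' ▸ hp⟩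
  · rintro ⟨⟨h2, hi⟩, hp⟩
    exact ⟨⟨h2, hi.trans (monotone_mW (by omega))⟩, (parentRank_succ (by omega) hi).trans_le hp⟩

theorem gAt_eq_of_le {l l' k : ℕ} (hk : k ≤ mW l) (hl : l ≤ l') : gAt l' k = gAt l k := by
  induction l', hl using Nat.le_induction with
  | base => rfl
  | succ l' hl ih => rw [gAt_succ (hk.trans (monotone_mW hl)), ih]

theorem gAt_eq_gk {k : ℕ} (hk : k ≤ mW l) : gAt l k = gk k := by
  rcases le_total l k with h | h
  · exact (gAt_eq_of_le hk h).symm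
  · exact gAt_eq_of_le (lt_mW_and_two_mul_le k).1.le h

theorem le_gk (k : ℕ) : k ≤ gk k := by
  rw [gk, gAt_eq]
  conv_lhs => rw [← Nat.add_sub_cancel k 1, ← Nat.card_Icc 1 k]
  refine card_le_card_of_surjOn (parentRank k) fun j hj => ?_
  have hj := mem_Icc.1 (mem_coe.1 hj)
  obtain ⟨i, hi, rfl⟩ := exists_parentRank_eq hj.1
    (hj.2.trans (lt_mW_and_two_mul_le k).1.le)
  exact ⟨i, mem_coe.2 (mem_filter.2 ⟨hi, hj.2⟩), rfl⟩

theorem parentRank_le_of_le_gAt {k r : ℕ} (hr : 2 ≤ r)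
    (h : r ≤ gAt l k + 1) : parentRank l r ≤ k := by
  by_contra! hlt
  have : gAt l k ≤ #(Icc 2 (r - 1)) := by
    rw [gAt_eq]
    refine card_le_card fun i hi => ?_
    simp only [mem_filter, mem_Icc] at hi ⊢
    refine ⟨hi.1.1, Nat.le_sub_one_of_lt ?_⟩
    by_contra! hri
    exact absurd (parentRank_mono (by omega) hri hi.1.2) (by omega)
  rw [Nat.card_Icc] at this
  omega

theorem gk_add_le (k : ℕ) : gk k + mW k + 1 ≤ mW (k + 1) + k := by
  have h1 := card_filter_add_card_filter_not (s := Icc 2 (mW (k + 1))) (fun i => parentRank k i ≤ k)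
  rw [← gAt_eq, Nat.card_Icc] at h1
  have h2 : #(Icc (k + 1) (mW k)) ≤ #{i ∈ Icc 2 (mW (k + 1)) | ¬parentRank k i ≤ k} := by
    refine card_le_card_of_surjOn (parentRank k) fun j hj => ?_
    have hj := mem_Icc.1 (mem_coe.1 hj)
    obtain ⟨i, hi, rfl⟩ := exists_parentRank_eq (by omega) hj.2
    exact ⟨i, mem_coe.2 (mem_filter.2 ⟨hi, by omega⟩), rfl⟩
  rw [Nat.card_Icc] at h2
  have := two_le_mW_succ k
  have := (lt_mW_and_two_mul_le k).1
  rw [gk]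
  omega

end ParentRank

section Jhom

variable {l : ℕ}

/-- The value at the word of rank `r` of the function on `W_l` encoded by `x ∈ ℤ^{m(l)-1}`:
the first word is sent to `0` and the word of rank `i + 1` to the `i`-th coordinate. -/
def valueAtRank (l : ℕ) (r : ℕ) : (Fin (mW l - 1) → ℤ) →ₗ[ℤ] ℤ :=
  if h : 2 ≤ r ∧ r ≤ mW l then LinearMap.proj ⟨r - 2, by omega⟩ else 0

theorem valueAtRank_add_two (x : Fin (mW l - 1) → ℤ) (i : Fin (mW l - 1)) :
    valueAtRank l (i + 2) x = x i := by
  have := i.2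
  rw [valueAtRank, dif_pos ⟨by omega, by omega⟩]
  rfl

theorem valueAtRank_one : valueAtRank l 1 = 0 := dif_neg (by omega)

theorem Jhom_apply (x : Fin (mW l - 1) → ℤ) (i : Fin (mW (l + 1) - 1)) :
    Jhom l x i = valueAtRank l (parentRank l (i + 2)) x := by
  have hi := i.2
  have h1 := one_le_parentRank (l := l) (i := i + 2) (by omega) (by omega)
  have key : ∀ j : Fin (mW l - 1),
      Jnat l (i + 1) (j + 1) = if parentRank l (i + 2) = j + 2 then 1 else 0 := fun j => by
    by_cases h : (i : ℕ) + 1 ≤ 1 ∨ (j : ℕ) + 1 = 0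
    · obtain h' : (i : ℕ) = 0 := by omega
      rw [Jnat, if_pos h, h', zero_add, parentRank_two, if_neg (by omega)]
    · rw [Jnat, if_neg h, Imat_eq]
      exact if_congr (and_iff_right (mem_Icc.2 (by omega))) rfl rfl
  change ∑ j : Fin (mW l - 1), Jnat l (i + 1) (j + 1) * x j = _
  simp only [key, ite_mul, one_mul, zero_mul]
  rcases h1.eq_or_lt with h | h
  · rw [← h, valueAtRank_one]
    exact sum_eq_zero fun j _ => if_neg (by omega)
  · have hle : parentRank l (i + 2) ≤ mW l := by
      obtain ⟨w, hw, hwi⟩ := exists_rankW_eq (l := l + 1) (i := i + 2) (by omega) (by omega)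
      rw [← hwi, parentRank_rankW hw]
      exact rankW_le (init_mem_Wset hw)
    obtain ⟨j, hj⟩ : ∃ j : Fin (mW l - 1), parentRank l (i + 2) = j + 2 :=
      ⟨⟨parentRank l (i + 2) - 2, by omega⟩, by simp only; omega⟩
    rw [hj, valueAtRank_add_two, Fintype.sum_eq_single j fun j' h => if_neg fun h' =>
      h (Fin.ext (by omega)), if_pos rfl]

theorem Jhom_mem_Zsub {k : ℕ} (hk : k ≤ l) {x : Fin (mW l - 1) → ℤ} (hx : x ∈ Zsub l k) :
    Jhom l x ∈ Zsub (l + 1) (k + 1) := by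
  intro i hi
  have hil := i.2
  have hkl : k + 1 ≤ mW l := by have := (lt_mW_and_two_mul_le l).1; omega
  have hp := parentRank_le_of_le_gAt (l := l) (k := k + 1) (r := i + 2) (by omega)
    (by rw [gAt_eq_gk hkl]; omega)
  rw [Jhom_apply, valueAtRank]
  split_ifs with h
  · refine hx _ ?_
    have := le_gk k
    simp only
    omega
  · rfl

theorem valueAtRank_Jhom (x : Fin (mW l - 1) → ℤ) {w : Fin (l + 1) → Fin 2}
    (hw : w ∈ Wset (l + 1)) :
    valueAtRank (l + 1) (rankW (l + 1) w) (Jhom l x) =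
      valueAtRank l (rankW l (Fin.init w)) x := by
  have hle := rankW_le hw
  rw [← parentRank_rankW hw]
  rcases (rankW_pos w).eq_or_lt with h | h
  · rw [← h, parentRank_one, valueAtRank_one, valueAtRank_one]
    rfl
  · obtain ⟨i, hi⟩ : ∃ i : Fin (mW (l + 1) - 1), rankW (l + 1) w = i + 2 :=
      ⟨⟨rankW (l + 1) w - 2, by omega⟩, by simp only; omega⟩
    rw [hi, valueAtRank_add_two, Jhom_apply]

end Jhom

section Cantor

/-- The letters of the infinite admissible word attached to `s ∈ 𝒦`: the `n`-th letter is `2`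
(coded by `1`) if `s n` is true and the preceding letter is not `2`. -/
def letter (s : Kspace) : ℕ → Fin 2
  | 0 => if s 0 then 1 else 0
  | n + 1 => if s (n + 1) ∧ letter s n = 0 then 1 else 0

/-- The first `l` letters of the infinite admissible word attached to `s ∈ 𝒦`. -/
def truncatedWord (l : ℕ) (s : Kspace) : Fin l → Fin 2 := fun i => letter s i

theorem truncatedWord_mem_Wset (l : ℕ) (s : Kspace) : truncatedWord l s ∈ Wset l := by
  refine mem_Wset.2 fun i j hij ⟨hi, hj⟩ => ?_
  rw [truncatedWord] at hi hj
  rw [hij, letter, hi] at hj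
  simp at hj

theorem exists_truncatedWord_eq {l : ℕ} {w : Fin l → Fin 2} (hw : w ∈ Wset l) :
    ∃ s, truncatedWord l s = w := by
  refine ⟨fun n => if h : n < l then w ⟨n, h⟩ = 1 else false, ?_⟩
  ext ⟨n, hn⟩ : 1
  have h01 : ∀ a : Fin 2, a ≠ 1 → a = 0 := by decide
  rw [truncatedWord]
  induction n with
  | zero =>
    by_cases h : w ⟨0, hn⟩ = 1
    · simp [letter, hn, h]
    · simp [letter, hn, h01 _ h]
  | succ n ih =>
    have ih := ih (by omega)
    simp only at ih ⊢
    rw [letter, ih]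
    by_cases h : w ⟨n + 1, hn⟩ = 1
    · have h0 : w ⟨n, by omega⟩ = 0 :=
        h01 _ fun h' => mem_Wset.1 hw ⟨n, by omega⟩ ⟨n + 1, hn⟩ rfl ⟨h', h⟩
      simp [hn, h, h0]
    · simp [hn, h01 _ h]

theorem continuous_letter (n : ℕ) : Continuous fun s => letter s n := by
  induction n with
  | zero =>
    have h : Continuous fun b : Bool => if b then (1 : Fin 2) else 0 :=
      continuous_of_discreteTopology
    exact h.comp (continuous_apply 0)
  | succ n ih =>
    have h : Continuous fun p : Bool × Fin 2 => if p.1 ∧ p.2 = 0 then (1 : Fin 2) else 0 :=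
      continuous_of_discreteTopology
    exact h.comp ((continuous_apply (n + 1)).prodMk ih)

theorem continuous_truncatedWord (l : ℕ) : Continuous (truncatedWord l) :=
  continuous_pi fun i => continuous_letter i

/-- The locally constant function on `𝒦` which depends only on the first `l` letters of the
attached admissible word, with values prescribed by `x ∈ ℤ^{m(l)-1}`. -/
def cylinderMap (l : ℕ) : (Fin (mW l - 1) → ℤ) →ₗ[ℤ] C(Kspace, ℤ) where
  toFun x := ⟨fun s => valueAtRank l (rankW l (truncatedWord l s)) x,
    (continuous_of_discreteTopology (f := fun w => valueAtRank l (rankW l w) x)).comp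
      (continuous_truncatedWord l)⟩
  map_add' x y := by ext s; simp
  map_smul' r x := by ext s; exact (valueAtRank l _).map_smul r x

theorem cylinderMap_apply (l : ℕ) (x : Fin (mW l - 1) → ℤ) (s : Kspace) :
    cylinderMap l x s = valueAtRank l (rankW l (truncatedWord l s)) x := rfl

theorem cylinderMap_Jhom (l : ℕ) (x : Fin (mW l - 1) → ℤ) :
    cylinderMap (l + 1) (Jhom l x) = cylinderMap l x := by
  ext s
  rw [cylinderMap_apply, valueAtRank_Jhom x (truncatedWord_mem_Wset (l + 1) s)]
  rfl

theorem exists_cylinderMap_apply_eq {l : ℕ} (i : Fin (mW l - 1)) :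
    ∃ s, ∀ x, cylinderMap l x s = x i := by
  have hi := i.2
  obtain ⟨w, hw, hwi⟩ := exists_rankW_eq (l := l) (i := i + 2) (by omega) (by omega)
  obtain ⟨s, rfl⟩ := exists_truncatedWord_eq hw
  exact ⟨s, fun x => by rw [cylinderMap_apply, hwi, valueAtRank_add_two]⟩

theorem cylinderMap_injective (l : ℕ) : Function.Injective (cylinderMap l) := by
  intro x y h
  ext i
  obtain ⟨s, hs⟩ := exists_cylinderMap_apply_eq i
  rw [← hs x, h, hs y]

instance isTorsionFree_continuousMap_int : Module.IsTorsionFree ℤ C(Kspace, ℤ) :=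
  Function.Injective.moduleIsTorsionFree (fun f : C(Kspace, ℤ) => (f : Kspace → ℤ))
    DFunLike.coe_injective fun _ _ => rfl

theorem exists_cylinderMap_eq_of_smul_eq {l k : ℕ} {r : ℤ} (hr : r ≠ 0) {f : C(Kspace, ℤ)}
    {x : Fin (mW l - 1) → ℤ} (hx : x ∈ Zsub l k) (h : cylinderMap l x = r • f) :
    ∃ y ∈ Zsub l k, cylinderMap l y = f := by
  choose s hs using exists_cylinderMap_apply_eq (l := l)
  have hxy : x = r • fun i => f (s i) := by
    ext i
    rw [← hs i x, h]
    rfl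
  refine ⟨fun i => f (s i), fun i hi => ?_, ?_⟩
  · have := hx i hi
    rw [hxy] at this
    exact (smul_eq_zero.1 this).resolve_left hr
  · rw [hxy, map_smul] at h
    exact smul_right_injective _ hr h

/-- The image in `C(𝒦,ℤ)` of the `n`-th group `ℤ(k+n;n)` of the inductive system. -/
def systemImage (k n : ℕ) : Submodule ℤ C(Kspace, ℤ) :=
  (Zsub (k + n) n).toIntSubmodule.map (cylinderMap (k + n))

theorem mem_systemImage {k n : ℕ} {f : C(Kspace, ℤ)} :
    f ∈ systemImage k n ↔ ∃ x ∈ Zsub (k + n) n, cylinderMap (k + n) x = f := Iff.rfl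

theorem systemImage_mono (k : ℕ) : Monotone (systemImage k) := by
  refine monotone_nat_of_le_succ fun n f hf => ?_
  obtain ⟨x, hx, rfl⟩ := mem_systemImage.1 hf
  exact mem_systemImage.2 ⟨Jhom (k + n) x, Jhom_mem_Zsub (Nat.le_add_left n k) hx,
    cylinderMap_Jhom (k + n) x⟩

theorem systemImage_fg (k n : ℕ) : (systemImage k n).FG :=
  (IsNoetherian.noetherian _).map _

theorem free_iSup_systemImage (k : ℕ) : Module.Free ℤ ↥(⨆ n, systemImage k n) := by
  refine free_iSup_of_monotone_of_pure (systemImage_mono k) (systemImage_fg k)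
    fun n r f hr hf => ?_
  obtain ⟨x, hx, h⟩ := mem_systemImage.1 hf
  exact mem_systemImage.2 (exists_cylinderMap_eq_of_smul_eq hr hx h)

theorem le_rank_iSup_systemImage {k : ℕ} (hk : 1 ≤ k) (N : ℕ) :
    (N : Cardinal) ≤ Module.rank ℤ ↥(⨆ n, systemImage k n) := by
  have hcard : gk (N + 2) + N ≤ mW (k + (N + 2)) - 1 := by
    have := gk_add_le (N + 2)
    have := (lt_mW_and_two_mul_le (N + 2)).2.1
    have := monotone_mW (show N + 2 + 1 ≤ k + (N + 2) by omega)
    omega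
  let a : Fin N → Fin (mW (k + (N + 2)) - 1) := fun i => ⟨gk (N + 2) + i, by omega⟩
  have ha : Function.Injective a := fun i j h => Fin.ext (by simpa [a] using h)
  have hmem : ∀ i, cylinderMap _ (Pi.single (a i) 1) ∈ ⨆ n, systemImage k n := fun i =>
    le_iSup (systemImage k) (N + 2) <| mem_systemImage.2
      ⟨_, fun j hj => Pi.single_eq_of_ne (fun h => by simp [h, a] at hj) _, rfl⟩
  have hind : LinearIndependent ℤ fun i => cylinderMap _ (Pi.single (a i) (1 : ℤ)) :=
    ((Pi.linearIndependent_single_one _ ℤ).comp a ha).map' _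
      (LinearMap.ker_eq_bot.2 (cylinderMap_injective _))
  have hind' : LinearIndependent ℤ
      fun i => (⟨_, hmem i⟩ : ↥(⨆ n, systemImage k n)) :=
    LinearIndependent.of_comp (Submodule.subtype _) hind
  simpa using hind'.cardinal_le_rank

end Cantor

/-- (0) the number `g_k` is independent of the level `l` (with `m(l) ≥ k`)
used to compute it; (i) the map given by `J_{l+1,l}` sends `ℤ(l;k)` into `ℤ(l+1;k+1)`;
(ii) for every `k ≥ 1` the inductive limit `G_k` of the system
`{J_{k+n+1,k+n} : ℤ(k+n;n) → ℤ(k+n+1;n+1)}_{n ≥ 0}` is isomorphic to `C(𝒦,ℤ)`,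
expressed by exhibiting a family of maps presenting `C(𝒦,ℤ)` as that inductive limit
(compatible, jointly surjective, with only eventually-vanishing elements in the kernels). -/
theorem Gk_iso_continuousFunctions (k : ℕ) (hk : 1 ≤ k) :
    (∀ l k' : ℕ, k' ≤ mW l → gAt l k' = gk k')
    ∧
    (∀ l k' : ℕ, k' ≤ l → ∀ x : Fin (mW l - 1) → ℤ,
        x ∈ Zsub l k' → Jhom l x ∈ Zsub (l + 1) (k' + 1))
    ∧
    (∃ θ : ∀ n : ℕ, ↥(Zsub (k + n) n) →+ ContinuousMap Kspace ℤ,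
      (∀ (n : ℕ) (x : ↥(Zsub (k + n) n)) (y : ↥(Zsub (k + n + 1) (n + 1))),
          (y : Fin (mW (k + n + 1) - 1) → ℤ) =
            Jhom (k + n) (x : Fin (mW (k + n) - 1) → ℤ) →
          θ (n + 1) y = θ n x) ∧
      (∀ f : ContinuousMap Kspace ℤ, ∃ (n : ℕ) (x : ↥(Zsub (k + n) n)), θ n x = f) ∧
      (∀ (n : ℕ) (x : ↥(Zsub (k + n) n)), θ n x = 0 →
          ∃ j : ℕ, Jpush (k + n) j (x : Fin (mW (k + n) - 1) → ℤ) = 0)) := by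
  refine ⟨fun l k' h => gAt_eq_gk h, fun l k' h x hx => Jhom_mem_Zsub h hx, ?_⟩
  have := free_iSup_systemImage k
  obtain ⟨e⟩ := nonempty_linearEquiv_continuousMap_int (le_rank_iSup_systemImage hk)
  have hmem : ∀ n (x : Zsub (k + n) n), cylinderMap (k + n) x ∈ ⨆ n, systemImage k n :=
    fun n x => le_iSup (systemImage k) n (mem_systemImage.2 ⟨x, x.2, rfl⟩)
  refine ⟨fun n => e.toAddMonoidHom.comp (((cylinderMap (k + n)).toAddMonoidHom.comp
    (Zsub (k + n) n).subtype).codRestrict (⨆ n, systemImage k n) (hmem n)), ?_, ?_, ?_⟩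
  · intro n x y hxy
    refine congrArg e (Subtype.ext ?_)
    change cylinderMap (k + n + 1) y = cylinderMap (k + n) x
    rw [hxy, cylinderMap_Jhom]
  · intro f
    obtain ⟨n, hn⟩ := (Submodule.mem_iSup_of_directed _ (systemImage_mono k).directed_le).1
      (e.symm f).2
    obtain ⟨x, hx, hxf⟩ := mem_systemImage.1 hn
    refine ⟨n, ⟨x, hx⟩, ?_⟩
    rw [← e.apply_symm_apply f]
    exact congrArg e (Subtype.ext hxf)
  · intro n x hx
    refine ⟨0, cylinderMap_injective _ ?_⟩
    have h0 := congrArg Subtype.val (e.map_eq_zero_iff.1 hx)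
    exact Eq.trans h0 (map_zero (cylinderMap (k + n))).symm
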